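/- Let Σ be a finitary signature, A a quantitative Σ-algebra on an extended pseudometric space, and q : A → A/∼ its metric reflection equipped with the induced quantitative Σ-algebra structure (the unique one making q a homomorphism). Then q is a reflection of A into quantitative Σ-algebras on extended metric spaces: for every quantitative Σ-algebra B on an extended metric space and every nonexpanding homomorphism f : A → B there exists a unique nonexpanding homomorphism f̄ : A/∼ → B with f = f̄ ∘ q. -/

import Mathlib

open ENNReal

/-- The metric reflection `q : A → B` of a quantitative `Σ`-algebra on an
extended pseudometric space, equipped with the induced algebra structure, is a reflection
into quantitative `Σ`-algebras on extended metric spaces: every nonexpanding homomorphism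
from `A` into a quantitative `Σ`-algebra `C` on an extended metric space factorizes
uniquely through `q` via a nonexpanding homomorphism. -/
theorem metric_reflection_universal_property.{u, v, w, z}
    {Sg : ℕ → Type u} {A : Type v} [PseudoEMetricSpace A]
    (opsA : ∀ n, Sg n → (Fin n → A) → A)
    (hopsA : ∀ n (σ : Sg n) (a b : Fin n → A), edist (opsA n σ a) (opsA n σ b) ≤ edist a b)
    {B : Type w} [EMetricSpace B] (q : A → B)
    (hq_surj : Function.Surjective q)
    (hq_pres : ∀ x y : A, edist (q x) (q y) = edist x y)
    (opsB : ∀ n, Sg n → (Fin n → B) → B)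
    (hopsB : ∀ n (σ : Sg n) (a b : Fin n → B), edist (opsB n σ a) (opsB n σ b) ≤ edist a b)
    (hq_hom : ∀ n (σ : Sg n) (a : Fin n → A),
      q (opsA n σ a) = opsB n σ (fun i => q (a i)))
    (C : Type z) [EMetricSpace C]
    (opsC : ∀ n, Sg n → (Fin n → C) → C)
    (hopsC : ∀ n (σ : Sg n) (a b : Fin n → C), edist (opsC n σ a) (opsC n σ b) ≤ edist a b)
    (f : A → C)
    (hf_ne : ∀ x y : A, edist (f x) (f y) ≤ edist x y)
    (hf_hom : ∀ n (σ : Sg n) (a : Fin n → A),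
      f (opsA n σ a) = opsC n σ (fun i => f (a i))) :
    ∃! g : B → C,
      (∀ x y : B, edist (g x) (g y) ≤ edist x y) ∧
      (∀ n (σ : Sg n) (b : Fin n → B), g (opsB n σ b) = opsC n σ (fun i => g (b i))) ∧
      f = g ∘ q := by
  have hfac : ∀ x y : A, q x = q y → f x = f y := fun x y h =>
    edist_le_zero.1 ((hf_ne x y).trans (by rw [← hq_pres, h, edist_self]))
  obtain ⟨s, hs⟩ := hq_surj.hasRightInverse
  have hfs : ∀ x : A, f (s (q x)) = f x := fun x => hfac _ _ (hs (q x))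
  refine ⟨f ∘ s, ⟨fun x y => ?_, fun n σ b => ?_, ?_⟩, ?_⟩
  · calc edist (f (s x)) (f (s y)) ≤ edist (s x) (s y) := hf_ne _ _
      _ = edist x y := by rw [← hq_pres, hs, hs]
  · have hb : opsB n σ b = q (opsA n σ (fun i => s (b i))) := by
      rw [hq_hom]
      exact congrArg (opsB n σ) (funext fun i => (hs (b i)).symm)
    simp only [Function.comp_apply]
    rw [hb, hfs, hf_hom]
  · exact funext fun x => (hfs x).symm
  · rintro g ⟨-, -, hg⟩
    funext b
    simp only [hg, Function.comp_apply, hs b]
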